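/- (Convergence rate of the composite method AAoptD(m, AA(1)) with one inner iteration.) Let g : ℝ^n → ℝ^n be a κ-contraction with fixed point x*, and suppose g has an L-Lipschitz derivative on B(x*, ρ). Fix an integer m ≥ 1 and a real M ≥ 1. Then there exists C > 0 depending only on κ, L, m and M such that the following holds. Suppose x_{k−m}, …, x_k ∈ B(x*, ρ) with f(x_k) ≠ 0; suppose α = (α_0, …, α_m) solves min ‖Σ_{i=0}^m α_i f(x_{k−m+i})‖ subject to Σ_{i=0}^m α_i = 1, with Σ_{i=0}^m |α_i| ≤ M; let x_k^α := Σ_{i=0}^m α_i x_{k−m+i} and x̃_k^α := Σ_{i=0}^m α_i g(x_{k−m+i}), assume x_k^α, x̃_k^α ∈ B(x*, ρ); let β_k ∈ [0,1] (the optimized damping factor) and set the damped outer step x̄_0 := x_k^α + β_k (x̃_k^α − x_k^α); let x̄_1 := g(x̄_0) and assume x̄_0, x̄_1 ∈ B(x*, ρ), f(x̄_1) ≠ 0, and ᾱ_0 x̄_0 + ᾱ_1 x̄_1 ∈ B(x*, ρ), where (ᾱ_0, ᾱ_1) solves min ‖ᾱ_0 f(x̄_0) + ᾱ_1 f(x̄_1)‖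 subject to ᾱ_0 + ᾱ_1 = 1, with |ᾱ_0| + |ᾱ_1| ≤ M; set x_{k+1} := ᾱ_0 g(x̄_0) + ᾱ_1 g(x̄_1). Define θ_{k+1} := ‖Σ_{i=0}^m α_i f(x_{k−m+i})‖ / ‖f(x_k)‖ and θ̄_1 := ‖ᾱ_0 f(x̄_0) + ᾱ_1 f(x̄_1)‖ / ‖f(x̄_1)‖. Then ‖f(x_{k+1})‖ ≤ θ̄_1 θ_{k+1} κ ((1 − β_k) + κ β_k) ‖f(x_k)‖ + C · ( Σ_{i=0}^m ‖f(x_{k−m+i})‖² + ‖f(x̄_0)‖² + ‖f(x̄_1)‖² ). -/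

import Mathlib

open Metric

/-- First-order Taylor estimate around `c` for a map whose derivative is `L`-Lipschitz at `c`. -/
theorem norm_sub_sub_fderiv_le_of_lipschitz_deriv
    {E F : Type*} [NormedAddCommGroup E] [NormedSpace ℝ E] [NormedAddCommGroup F] [NormedSpace ℝ F]
    {g : E → F} {g' : E → E →L[ℝ] F} {c x : E} {ρ L : ℝ} (hL : 0 ≤ L)
    (hg : ∀ y ∈ closedBall c ρ, HasFDerivAt g (g' y) y)
    (hlip : ∀ y ∈ closedBall c ρ, ‖g' y - g' c‖ ≤ L * ‖y - c‖)
    (hx : x ∈ closedBall c ρ) :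
    ‖g x - g c - g' c (x - c)‖ ≤ L * ‖x - c‖ ^ 2 := by
  have hsub : closedBall c ‖x - c‖ ⊆ closedBall c ρ :=
    closedBall_subset_closedBall (by simpa [dist_eq_norm] using hx)
  have h := (convex_closedBall c ‖x - c‖).norm_image_sub_le_of_norm_hasFDerivWithin_le'
    (f := g) (f' := g') (φ := g' c) (C := L * ‖x - c‖) (x := c) (y := x)
    (fun y hy => (hg y (hsub hy)).hasFDerivWithinAt)
    (fun y hy => (hlip y (hsub hy)).trans <| mul_le_mul_of_nonneg_left
      (by simpa [dist_eq_norm] using hy) hL)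
    (mem_closedBall_self (norm_nonneg _)) (by simp [dist_eq_norm])
  linarith [h, sq (‖x - c‖)]

/-- Weighted Cauchy–Schwarz: `‖∑ αᵢ vᵢ‖² ≤ M² ∑ ‖vᵢ‖²` as soon as `∑ |αᵢ| ≤ M`. -/
theorem norm_sum_smul_sq_le {E ι : Type*} [NormedAddCommGroup E] [NormedSpace ℝ E] [Fintype ι]
    {α : ι → ℝ} {M : ℝ} (hα : ∑ i, |α i| ≤ M) (v : ι → E) :
    ‖∑ i, α i • v i‖ ^ 2 ≤ M ^ 2 * ∑ i, ‖v i‖ ^ 2 := by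
  have hsq : ∑ i, |α i| ^ 2 ≤ M ^ 2 :=
    (Finset.sum_sq_le_sq_sum_of_nonneg fun i _ => abs_nonneg (α i)).trans
      (pow_le_pow_left₀ (Finset.sum_nonneg fun i _ => abs_nonneg (α i)) hα 2)
  calc ‖∑ i, α i • v i‖ ^ 2 ≤ (∑ i, |α i| * ‖v i‖) ^ 2 := by
        gcongr
        exact norm_sum_le_of_le _ fun i _ => by rw [norm_smul, Real.norm_eq_abs]
    _ ≤ (∑ i, |α i| ^ 2) * ∑ i, ‖v i‖ ^ 2 := Finset.sum_mul_sq_le_sq_mul_sq _ _ _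
    _ ≤ M ^ 2 * ∑ i, ‖v i‖ ^ 2 := by gcongr

/-- The distance to a fixed point of a contraction is controlled by the residual. -/
theorem norm_sub_fixedPoint_le {E : Type*} [NormedAddCommGroup E] {g : E → E} {c : E} {κ : ℝ}
    (hκ : κ < 1) (hc : g c = c) (hg : ∀ x y, ‖g y - g x‖ ≤ κ * ‖y - x‖) (x : E) :
    ‖x - c‖ ≤ ‖g x - x‖ / (1 - κ) := by
  rw [le_div_iff₀ (by linarith)]
  have h := hg c x
  rw [hc] at h
  have htri := norm_sub_le_norm_sub_add_norm_sub x (g x) c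
  rw [norm_sub_rev x (g x)] at htri
  linarith

/-- A contraction with Lipschitz derivative commutes with affine combinations up to an error
quadratic in the residuals. -/
theorem norm_map_affineCombination_sub_le
    {E ι : Type*} [NormedAddCommGroup E] [NormedSpace ℝ E] [Fintype ι]
    {g : E → E} {g' : E → E →L[ℝ] E} {c : E} {ρ L κ M : ℝ}
    (hL : 0 ≤ L) (hκ : κ < 1) (hM : 1 ≤ M) (hc : g c = c)
    (hcontr : ∀ x y, ‖g y - g x‖ ≤ κ * ‖y - x‖)
    (hg : ∀ y ∈ closedBall c ρ, HasFDerivAt g (g' y) y)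
    (hlip : ∀ y ∈ closedBall c ρ, ∀ z ∈ closedBall c ρ, ‖g' y - g' z‖ ≤ L * ‖y - z‖)
    {x : ι → E} {α : ι → ℝ} (hx : ∀ i, x i ∈ closedBall c ρ) (hsum : ∑ i, α i = 1)
    (hα : ∑ i, |α i| ≤ M) (hxα : ∑ i, α i • x i ∈ closedBall c ρ) :
    ‖g (∑ i, α i • x i) - ∑ i, α i • g (x i)‖ ≤
      2 * L * M ^ 2 / (1 - κ) ^ 2 * ∑ i, ‖g (x i) - x i‖ ^ 2 := by
  have hcc : c ∈ closedBall c ρ := mem_closedBall_self (dist_nonneg.trans hxα)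
  have hR (y : E) (hy : y ∈ closedBall c ρ) : ‖g y - g c - g' c (y - c)‖ ≤ L * ‖y - c‖ ^ 2 :=
    norm_sub_sub_fderiv_le_of_lipschitz_deriv hL hg (fun z hz => hlip z hz c hcc) hy
  have haff : ∑ i, α i • x i - c = ∑ i, α i • (x i - c) := by
    simp [smul_sub, Finset.sum_sub_distrib, ← Finset.sum_smul, hsum]
  have hdecomp : g (∑ i, α i • x i) - ∑ i, α i • g (x i) =
      (g (∑ i, α i • x i) - g c - g' c (∑ i, α i • x i - c)) -
        ∑ i, α i • (g (x i) - g c - g' c (x i - c)) := by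
    have : ∑ i, α i • (g (x i) - g c - g' c (x i - c)) =
        ∑ i, α i • g (x i) - g c - g' c (∑ i, α i • x i - c) := by
      rw [haff, map_sum]
      simp only [map_smul]
      simp only [smul_sub, Finset.sum_sub_distrib, ← Finset.sum_smul, hsum, one_smul]
    rw [this]
    abel
  have hsumR : ‖∑ i, α i • (g (x i) - g c - g' c (x i - c))‖ ≤
      M ^ 2 * (L * ∑ i, ‖x i - c‖ ^ 2) := by
    rw [Finset.mul_sum, Finset.mul_sum]
    refine norm_sum_le_of_le _ fun i _ => ?_
    rw [norm_smul, Real.norm_eq_abs]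
    have hi : |α i| ≤ M ^ 2 :=
      ((Finset.single_le_sum (fun j _ => abs_nonneg (α j)) (Finset.mem_univ i)).trans hα).trans
        (le_self_pow₀ hM two_ne_zero)
    exact mul_le_mul hi (hR _ (hx i)) (norm_nonneg _) (by positivity)
  have hmain : ‖g (∑ i, α i • x i) - g c - g' c (∑ i, α i • x i - c)‖ ≤
      L * (M ^ 2 * ∑ i, ‖x i - c‖ ^ 2) := by
    refine (hR _ hxα).trans (mul_le_mul_of_nonneg_left ?_ hL)
    rw [haff]
    exact norm_sum_smul_sq_le hα _
  have hres : ∑ i, ‖x i - c‖ ^ 2 ≤ (∑ i, ‖g (x i) - x i‖ ^ 2) / (1 - κ) ^ 2 := by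
    rw [Finset.sum_div]
    refine Finset.sum_le_sum fun i _ => ?_
    rw [← div_pow]
    exact pow_le_pow_left₀ (norm_nonneg _) (norm_sub_fixedPoint_le hκ hc hcontr _) 2
  calc ‖g (∑ i, α i • x i) - ∑ i, α i • g (x i)‖
      ≤ 2 * L * M ^ 2 * ∑ i, ‖x i - c‖ ^ 2 := by
        rw [hdecomp]
        linarith [norm_sub_le (g (∑ i, α i • x i) - g c - g' c (∑ i, α i • x i - c))
          (∑ i, α i • (g (x i) - g c - g' c (x i - c)))]
    _ ≤ 2 * L * M ^ 2 * ((∑ i, ‖g (x i) - x i‖ ^ 2) / (1 - κ) ^ 2) := by gcongr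
    _ = _ := by ring

/-- Residual after a damped step from `y` towards `z`, for a contraction `g`. -/
theorem norm_residual_damped_le {E : Type*} [NormedAddCommGroup E] [NormedSpace ℝ E]
    {g : E → E} {κ β : ℝ} (hcontr : ∀ x y, ‖g y - g x‖ ≤ κ * ‖y - x‖)
    (hβ₀ : 0 ≤ β) (hβ₁ : β ≤ 1) (y z : E) :
    ‖g (y + β • (z - y)) - (y + β • (z - y))‖ ≤
      ((1 - β) + κ * β) * ‖z - y‖ + ‖g y - z‖ := by
  have hdecomp : g (y + β • (z - y)) - (y + β • (z - y)) =
      (g (y + β • (z - y)) - g y) + (1 - β) • (z - y) + (g y - z) := by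
    module
  have h := hcontr y (y + β • (z - y))
  rw [add_sub_cancel_left, norm_smul, Real.norm_of_nonneg hβ₀] at h
  have hn : ‖(1 - β) • (z - y)‖ = (1 - β) * ‖z - y‖ := by
    rw [norm_smul, Real.norm_of_nonneg (by linarith)]
  rw [hdecomp]
  linarith [norm_add₃_le (a := g (y + β • (z - y)) - g y) (b := (1 - β) • (z - y)) (c := g y - z)]

/-- Bound on `κ R` when the residual `R` is a fraction `R / F₁ ≤ 1` of `F₁`, where `F₁ ≤ κ F₀` and
`F₀` is at most `B` up to an error `e ≤ T`. -/
theorem contraction_gain_mul_le {κ R F₁ F₀ B e T : ℝ} (hκ0 : 0 ≤ κ) (hκ1 : κ ≤ 1) (hR : 0 ≤ R)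
    (hRF : R ≤ F₁) (hF₁ : 0 < F₁) (hF₀ : 0 ≤ F₀) (hT : 0 ≤ T) (h₁ : F₁ ≤ κ * F₀)
    (h₀ : F₀ ≤ B + e) (he : e ≤ T) :
    κ * R ≤ R / F₁ * κ * B + T := by
  have hθ0 : 0 ≤ R / F₁ * κ := by positivity
  have hθ1 : R / F₁ * κ ≤ 1 := mul_le_one₀ (div_le_one_of_le₀ hRF hF₁.le) hκ0 hκ1
  calc κ * R = R / F₁ * κ * F₁ := by field_simp
    _ ≤ R / F₁ * κ * (B + T) := by
        gcongr
        linarith [mul_le_of_le_one_left hF₀ hκ1]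
    _ ≤ R / F₁ * κ * B + T := by
        rw [mul_add]
        gcongr
        exact mul_le_of_le_one_left hT hθ1

/-- Convergence rate of the composite method `AAoptD(m, AA(1))` with one
inner iteration.  For a κ-contraction `g` with fixed point `xstar` whose derivative is
`L`-Lipschitz on `B(xstar, ρ)`, there is `C > 0` depending only on `κ, L, m, M` such that:
if `x (k-m), …, x k ∈ B` with `f (x k) ≠ 0`, `α` solves the outer constrained
minimization with `∑ |α i| ≤ M`; `x_k^α = ∑ α i • x (k-m+i)` and
`x̃_k^α = ∑ α i • g (x (k-m+i))` lie in `B`; `β ∈ [0,1]` is the (optimized) damping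
factor; the damped outer step is `x̄₀ = x_k^α + β • (x̃_k^α - x_k^α)` with `x̄₁ = g x̄₀`,
both in `B`, `f x̄₁ ≠ 0`; `(ᾱ₀, ᾱ₁)` solves the inner AA(1) minimization with
`ᾱ₀ + ᾱ₁ = 1`, `|ᾱ₀| + |ᾱ₁| ≤ M`, `ᾱ₀ • x̄₀ + ᾱ₁ • x̄₁ ∈ B`; and
`x_{k+1} = ᾱ₀ • g x̄₀ + ᾱ₁ • g x̄₁`; then
`‖f x_{k+1}‖ ≤ θ̄₁ θ_{k+1} κ ((1-β) + κ β) ‖f (x k)‖ +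
  C (∑ ‖f (x (k-m+i))‖² + ‖f x̄₀‖² + ‖f x̄₁‖²)`
where `θ_{k+1}` and `θ̄₁` are the two gains and `f x = g x - x`. -/
theorem AAoptD_m_AA1_convergence_rate
    (κ L M : ℝ) (m : ℕ) (hm : 1 ≤ m)
    (hκ0 : 0 < κ) (hκ1 : κ < 1) (hL : 0 ≤ L) (hM : 1 ≤ M) :
    ∃ C > 0, ∀ (n : ℕ)
      (g : EuclideanSpace ℝ (Fin n) → EuclideanSpace ℝ (Fin n))
      (g' : EuclideanSpace ℝ (Fin n) →
        (EuclideanSpace ℝ (Fin n) →L[ℝ] EuclideanSpace ℝ (Fin n)))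
      (xstar : EuclideanSpace ℝ (Fin n)) (ρ : ℝ),
      g xstar = xstar →
      (∀ x y, ‖g y - g x‖ ≤ κ * ‖y - x‖) →
      (∀ x ∈ Metric.closedBall xstar ρ, HasFDerivAt g (g' x) x) →
      (∀ x ∈ Metric.closedBall xstar ρ, ∀ y ∈ Metric.closedBall xstar ρ,
        ‖g' x - g' y‖ ≤ L * ‖x - y‖) →
      ∀ (k : ℕ), m ≤ k →
      ∀ (x : ℕ → EuclideanSpace ℝ (Fin n)) (α : Fin (m + 1) → ℝ) (β a₀ a₁ : ℝ)
        (xb0 xb1 xnext : EuclideanSpace ℝ (Fin n)),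
        (∀ i : Fin (m + 1), x (k - m + (i : ℕ)) ∈ Metric.closedBall xstar ρ) →
        g (x k) - x k ≠ 0 →
        (∑ i, α i) = 1 →
        (∀ α' : Fin (m + 1) → ℝ, (∑ i, α' i) = 1 →
          ‖∑ i, α i • (g (x (k - m + (i : ℕ))) - x (k - m + (i : ℕ)))‖ ≤
          ‖∑ i, α' i • (g (x (k - m + (i : ℕ))) - x (k - m + (i : ℕ)))‖) →
        (∑ i, |α i|) ≤ M →
        (∑ i, α i • x (k - m + (i : ℕ))) ∈ Metric.closedBall xstar ρ →
        (∑ i, α i • g (x (k - m + (i : ℕ)))) ∈ Metric.closedBall xstar ρ →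
        0 ≤ β → β ≤ 1 →
        xb0 = (∑ i, α i • x (k - m + (i : ℕ))) +
              β • ((∑ i, α i • g (x (k - m + (i : ℕ)))) -
                   (∑ i, α i • x (k - m + (i : ℕ)))) →
        xb1 = g xb0 →
        xb0 ∈ Metric.closedBall xstar ρ →
        xb1 ∈ Metric.closedBall xstar ρ →
        g xb1 - xb1 ≠ 0 →
        a₀ + a₁ = 1 →
        (∀ b₀ b₁ : ℝ, b₀ + b₁ = 1 →
          ‖a₀ • (g xb0 - xb0) + a₁ • (g xb1 - xb1)‖ ≤
          ‖b₀ • (g xb0 - xb0) + b₁ • (g xb1 - xb1)‖) →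
        |a₀| + |a₁| ≤ M →
        a₀ • xb0 + a₁ • xb1 ∈ Metric.closedBall xstar ρ →
        xnext = a₀ • g xb0 + a₁ • g xb1 →
        ‖g xnext - xnext‖ ≤
          (‖a₀ • (g xb0 - xb0) + a₁ • (g xb1 - xb1)‖ / ‖g xb1 - xb1‖) *
            (‖∑ i, α i • (g (x (k - m + (i : ℕ))) - x (k - m + (i : ℕ)))‖ /
              ‖g (x k) - x k‖) * κ * ((1 - β) + κ * β) * ‖g (x k) - x k‖ +
          C * ((∑ i : Fin (m + 1),
                  ‖g (x (k - m + (i : ℕ))) - x (k - m + (i : ℕ))‖ ^ 2) +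
               ‖g xb0 - xb0‖ ^ 2 + ‖g xb1 - xb1‖ ^ 2) := by
  set K : ℝ := 2 * L * M ^ 2 / (1 - κ) ^ 2 with hK
  have hK0 : 0 ≤ K := by positivity
  refine ⟨K + 1, by positivity, ?_⟩
  intro n g g' c ρ hc hcontr hg hlip k _ x α β a₀ a₁ y₀ y₁ z hx hfk hsum _ hα hxα _ hβ₀ hβ₁
    hy₀ hy₁ hy₀B hy₁B hfy₁ hasum hmin ha haB hz
  have houter := norm_map_affineCombination_sub_le hL hκ1 hM hc hcontr hg hlip hx hsum hα hxα
  have hinner := norm_map_affineCombination_sub_le hL hκ1 hM hc hcontr hg hlip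
    (x := ![y₀, y₁]) (α := ![a₀, a₁]) (by simp [Fin.forall_fin_two, hy₀B, hy₁B, -mem_closedBall])
    (by simpa using hasum) (by simpa using ha) (by simpa [-mem_closedBall] using haB)
  simp only [Fin.sum_univ_two, Matrix.cons_val_zero, Matrix.cons_val_one] at hinner
  rw [← hK] at houter hinner
  have hdamped := norm_residual_damped_le hcontr hβ₀ hβ₁ (∑ i, α i • x (k - m + (i : ℕ)))
    (∑ i, α i • g (x (k - m + (i : ℕ))))
  rw [← hy₀, ← Finset.sum_sub_distrib] at hdamped
  simp only [← smul_sub] at hdamped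
  have hfy₁_le : ‖g y₁ - y₁‖ ≤ κ * ‖g y₀ - y₀‖ := by
    simpa only [← hy₁] using hcontr y₀ y₁
  have hnext : ‖g z - z‖ ≤ κ * ‖a₀ • (g y₀ - y₀) + a₁ • (g y₁ - y₁)‖ +
      K * (‖g y₀ - y₀‖ ^ 2 + ‖g y₁ - y₁‖ ^ 2) := by
    have h := hcontr (a₀ • y₀ + a₁ • y₁) z
    have hstep : z - (a₀ • y₀ + a₁ • y₁) = a₀ • (g y₀ - y₀) + a₁ • (g y₁ - y₁) := by
      rw [hz]; module
    rw [hstep] at h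
    rw [← hz] at hinner
    linarith [norm_sub_le_norm_sub_add_norm_sub (g z) (g (a₀ • y₀ + a₁ • y₁)) z]
  have hgain := hmin 0 1 (by norm_num)
  rw [zero_smul, zero_add, one_smul] at hgain
  have hF₁ : 0 < ‖g y₁ - y₁‖ := norm_pos_iff.mpr hfy₁
  have hFk : ‖g (x k) - x k‖ ≠ 0 := norm_ne_zero_iff.mpr hfk
  have hθ := contraction_gain_mul_le hκ0.le hκ1.le (norm_nonneg _) hgain hF₁ (norm_nonneg _)
    (mul_nonneg hK0 (Finset.sum_nonneg fun i _ => sq_nonneg _)) hfy₁_le hdamped houter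
  have hcancel (A F θ : ℝ) (hF : F ≠ 0) :
      θ * (A / F) * κ * ((1 - β) + κ * β) * F = θ * κ * (((1 - β) + κ * β) * A) := by
    field_simp
  rw [hcancel _ _ _ hFk]
  have hS : 0 ≤ ∑ i : Fin (m + 1), ‖g (x (k - m + (i : ℕ))) - x (k - m + (i : ℕ))‖ ^ 2 :=
    Finset.sum_nonneg fun i _ => sq_nonneg _
  linarith [sq_nonneg ‖g y₀ - y₀‖, sq_nonneg ‖g y₁ - y₁‖]
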